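/- In any occurrence net, the finite cuts are exactly the reachable markings; that is, every reachable marking is a finite cut, and every finite cut can be reached from the initial marking by firing a finite sequence of transitions. -/

import Mathlib

/-- A Petri net over places `P` and transitions `T`: each transition has a
nonempty finite multiset precondition and postcondition (encoding the flow
relation `F`), and there is a finite initial marking. -/
structure PetriNet (P T : Type) where
  pre  : T → Multiset P
  post : T → Multiset P
  init : Multiset P
  pre_ne  : ∀ t, pre t ≠ 0
  post_ne : ∀ t, post t ≠ 0

namespace PetriNet

variable {P T : Type}

/-- A transition `t` is enabled in a marking `M` if `pre t ⊆ M`. -/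
def Enabled (N : PetriNet P T) (M : Multiset P) (t : T) : Prop :=
  N.pre t ≤ M

/-- `M →t M'`: firing an enabled transition. -/
def Fires [DecidableEq P] (N : PetriNet P T) (M : Multiset P) (t : T) (M' : Multiset P) : Prop :=
  N.pre t ≤ M ∧ M' = M - N.pre t + N.post t

def Step [DecidableEq P] (N : PetriNet P T) (M M' : Multiset P) : Prop :=
  ∃ t, N.Fires M t M'

/-- A marking is reachable if obtained from the initial marking by firing a
finite sequence of transitions. -/
def Reachable [DecidableEq P] (N : PetriNet P T) (M : Multiset P) : Prop :=
  Relation.ReflTransGen N.Step N.init M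

/-- The flow relation on nodes (places ⊕ transitions). -/
def Flow (N : PetriNet P T) : P ⊕ T → P ⊕ T → Prop
  | Sum.inl p, Sum.inr t => p ∈ N.pre t
  | Sum.inr t, Sum.inl p => p ∈ N.post t
  | _, _ => False

/-- `<` : transitive closure of the flow relation. -/
def CLt (N : PetriNet P T) : P ⊕ T → P ⊕ T → Prop := Relation.TransGen N.Flow

/-- `≤` : reflexive-transitive closure of the flow relation. -/
def CLe (N : PetriNet P T) : P ⊕ T → P ⊕ T → Prop := Relation.ReflTransGen N.Flow

/-- Nodes `x`, `y` are in conflict if from some place `q` (distinct from both)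
one can reach `x` and `y` via two different outgoing transitions of `q`. -/
def Conflict (N : PetriNet P T) (x y : P ⊕ T) : Prop :=
  ∃ q : P, Sum.inl q ≠ x ∧ Sum.inl q ≠ y ∧
    ∃ t₁ t₂ : T, t₁ ≠ t₂ ∧ q ∈ N.pre t₁ ∧ q ∈ N.pre t₂ ∧
      N.CLe (Sum.inr t₁) x ∧ N.CLe (Sum.inr t₂) y

/-- Concurrent: neither causally related nor in conflict. -/
def Concurrent (N : PetriNet P T) (x y : P ⊕ T) : Prop :=
  ¬ N.CLe x y ∧ ¬ N.CLe y x ∧ ¬ N.Conflict x y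

/-- Occurrence net: pre/postconditions are sets, every place has at most one
incoming transition, the initial marking is the set of places without incoming
transitions, the inverse flow relation is well-founded, and no transition is in
self-conflict. -/
structure IsOccurrence (N : PetriNet P T) : Prop where
  pre_nodup : ∀ t, (N.pre t).Nodup
  post_nodup : ∀ t, (N.post t).Nodup
  unique_pre : ∀ p : P, ∀ t₁ t₂ : T, p ∈ N.post t₁ → p ∈ N.post t₂ → t₁ = t₂
  init_nodup : N.init.Nodup
  mem_init : ∀ p : P, p ∈ N.init ↔ ∀ t : T, p ∉ N.post t
  wf : WellFounded N.Flow
  no_self_conflict : ∀ t : T, ¬ N.Conflict (Sum.inr t) (Sum.inr t)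

def PairwiseConcurrent (N : PetriNet P T) (C : Set P) : Prop :=
  ∀ p ∈ C, ∀ q ∈ C, p ≠ q → N.Concurrent (Sum.inl p) (Sum.inl q)

/-- A cut: a maximal set of pairwise concurrent places. -/
def IsCut (N : PetriNet P T) (C : Set P) : Prop :=
  N.PairwiseConcurrent C ∧ ∀ D : Set P, N.PairwiseConcurrent D → C ⊆ D → D = C

end PetriNet

/-- `(N₁, fP, fT)` is an initial branching process of `N₂`: `N₁` is an
occurrence net, `(fP, fT)` is an initial homomorphism, and transitions with the
same precondition and the same image coincide. -/
structure IsBranchingProcess {P₁ T₁ P₂ T₂ : Type}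
    (N₁ : PetriNet P₁ T₁) (N₂ : PetriNet P₂ T₂)
    (fP : P₁ → P₂) (fT : T₁ → T₂) : Prop where
  occ : N₁.IsOccurrence
  map_pre : ∀ t, (N₁.pre t).map fP = N₂.pre (fT t)
  map_post : ∀ t, (N₁.post t).map fP = N₂.post (fT t)
  map_init : N₁.init.map fP = N₂.init
  trans_inj : ∀ t₁ t₂, N₁.pre t₁ = N₁.pre t₂ → fT t₁ = fT t₂ → t₁ = t₂

namespace PetriNet

variable {P T : Type} {N : PetriNet P T}

/-- The nodes `x` and `y` lie above different outgoing transitions of a common place. -/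
def Branch (N : PetriNet P T) (x y : P ⊕ T) : Prop :=
  ∃ (r : P) (t₁ t₂ : T), t₁ ≠ t₂ ∧ r ∈ N.pre t₁ ∧ r ∈ N.pre t₂ ∧
    N.CLe (Sum.inr t₁) x ∧ N.CLe (Sum.inr t₂) y

/-- Two nodes are incompatible if they are strictly causally related or branch apart. -/
def Incompatible (N : PetriNet P T) (x y : P ⊕ T) : Prop :=
  N.CLt x y ∨ N.CLt y x ∨ N.Branch x y

theorem Branch.symm {x y : P ⊕ T} : N.Branch x y → N.Branch y x := by
  rintro ⟨r, t₁, t₂, hne, h₁, h₂, hx, hy⟩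
  exact ⟨r, t₂, t₁, hne.symm, h₂, h₁, hy, hx⟩

theorem Branch.mono {x x' y y' : P ⊕ T} (h : N.Branch x y) (hx : N.CLe x x')
    (hy : N.CLe y y') : N.Branch x' y' := by
  obtain ⟨r, t₁, t₂, hne, h₁, h₂, hx', hy'⟩ := h
  exact ⟨r, t₁, t₂, hne, h₁, h₂, hx'.trans hx, hy'.trans hy⟩

theorem Incompatible.symm {x y : P ⊕ T} : N.Incompatible x y → N.Incompatible y x := by
  rintro (h | h | h)
  · exact Or.inr (Or.inl h)
  · exact Or.inl h
  · exact Or.inr (Or.inr h.symm)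

theorem CLe.eq_or_lt {x y : P ⊕ T} (h : N.CLe x y) : x = y ∨ N.CLt x y := by
  rcases Relation.reflTransGen_iff_eq_or_transGen.1 h with h | h
  · exact Or.inl h.symm
  · exact Or.inr h

theorem CLt.le {x y : P ⊕ T} (h : N.CLt x y) : N.CLe x y :=
  Relation.TransGen.to_reflTransGen h

theorem CLt.trans {x y z : P ⊕ T} (h : N.CLt x y) (h' : N.CLt y z) : N.CLt x z :=
  Relation.TransGen.trans h h'

theorem CLt.trans_le {x y z : P ⊕ T} (h : N.CLt x y) (h' : N.CLe y z) : N.CLt x z :=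
  Relation.TransGen.trans_left h h'

theorem CLe.trans_lt {x y z : P ⊕ T} (h : N.CLe x y) (h' : N.CLt y z) : N.CLt x z :=
  Relation.TransGen.trans_right h h'

theorem clt_of_mem_pre {p : P} {t : T} (h : p ∈ N.pre t) :
    N.CLt (Sum.inl p) (Sum.inr t) :=
  Relation.TransGen.single h

theorem clt_of_mem_post {p : P} {t : T} (h : p ∈ N.post t) :
    N.CLt (Sum.inr t) (Sum.inl p) :=
  Relation.TransGen.single h

theorem CLe.lt_place {p : P} {t : T} (h : N.CLe (Sum.inr t) (Sum.inl p)) :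
    N.CLt (Sum.inr t) (Sum.inl p) := by
  rcases h.eq_or_lt with h | h
  · cases h
  · exact h

theorem CLt.exists_pre {x : P ⊕ T} {t : T} (h : N.CLt x (Sum.inr t)) :
    ∃ s ∈ N.pre t, N.CLe x (Sum.inl s) := by
  obtain ⟨s | u, hx, hs⟩ := Relation.TransGen.tail'_iff.1 h
  · exact ⟨s, hs, hx⟩
  · exact hs.elim

theorem CLt.exists_in {x : P ⊕ T} {p : P} (h : N.CLt x (Sum.inl p)) :
    ∃ t, p ∈ N.post t ∧ N.CLe x (Sum.inr t) := by
  obtain ⟨s | u, hx, hs⟩ := Relation.TransGen.tail'_iff.1 h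
  · exact hs.elim
  · exact ⟨u, hs, hx⟩

theorem CLt.exists_out {x : P ⊕ T} {p : P} (h : N.CLt (Sum.inl p) x) :
    ∃ t, p ∈ N.pre t ∧ N.CLe (Sum.inr t) x := by
  obtain ⟨s | u, hs, hx⟩ := Relation.TransGen.head'_iff.1 h
  · exact hs.elim
  · exact ⟨u, hs, hx⟩

theorem CLt.exists_post {x : P ⊕ T} {t : T} (h : N.CLt (Sum.inr t) x) :
    ∃ q ∈ N.post t, N.CLe (Sum.inl q) x := by
  obtain ⟨s | u, hs, hx⟩ := Relation.TransGen.head'_iff.1 h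
  · exact ⟨s, hs, hx⟩
  · exact hs.elim

theorem Incompatible.of_not_concurrent {x y : P ⊕ T} (hne : x ≠ y)
    (h : ¬ N.Concurrent x y) : N.Incompatible x y := by
  by_contra hi
  refine h ⟨fun hxy => ?_, fun hyx => ?_, ?_⟩
  · exact hi (Or.inl (hxy.eq_or_lt.resolve_left hne))
  · exact hi (Or.inr (Or.inl (hyx.eq_or_lt.resolve_left hne.symm)))
  · rintro ⟨q, -, -, t₁, t₂, hc⟩
    exact hi (Or.inr (Or.inr ⟨q, t₁, t₂, hc⟩))

theorem Incompatible.not_concurrent {x y : P ⊕ T} (h : N.Incompatible x y) :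
    ¬ N.Concurrent x y := by
  rintro ⟨hxy, hyx, hc⟩
  rcases h with h | h | ⟨r, t₁, t₂, hne, h₁, h₂, hx, hy⟩
  · exact hxy h.le
  · exact hyx h.le
  · refine hc ⟨r, ?_, ?_, t₁, t₂, hne, h₁, h₂, hx, hy⟩
    · rintro rfl
      exact hxy ((clt_of_mem_pre h₂).trans_le hy).le
    · rintro rfl
      exact hyx ((clt_of_mem_pre h₁).trans_le hx).le

namespace IsOccurrence

theorem not_clt_self (hN : N.IsOccurrence) (x : P ⊕ T) : ¬ N.CLt x x :=
  fun h => hN.wf.transGen.irrefl.irrefl x h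

theorem le_of_lt_post (hN : N.IsOccurrence) {x : P ⊕ T} {p : P} {t : T}
    (hp : p ∈ N.post t) (h : N.CLt x (Sum.inl p)) : N.CLe x (Sum.inr t) := by
  obtain ⟨u, hu, hx⟩ := h.exists_in
  rwa [hN.unique_pre p t u hp hu]

theorem branch_post_left (hN : N.IsOccurrence) {p : P} {t : T} {y : P ⊕ T}
    (hp : p ∈ N.post t) (h : N.Branch (Sum.inl p) y) : N.Branch (Sum.inr t) y := by
  obtain ⟨r, t₁, t₂, hne, h₁, h₂, hx, hy⟩ := h
  exact ⟨r, t₁, t₂, hne, h₁, h₂, hN.le_of_lt_post hp hx.lt_place, hy⟩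

theorem not_branch_self (hN : N.IsOccurrence) (x : P ⊕ T) : ¬ N.Branch x x := by
  have htrans : ∀ t : T, ¬ N.Branch (Sum.inr t) (Sum.inr t) := by
    rintro t ⟨r, t₁, t₂, hc⟩
    exact hN.no_self_conflict t ⟨r, Sum.inl_ne_inr, Sum.inl_ne_inr, t₁, t₂, hc⟩
  rcases x with p | t
  · intro h
    obtain ⟨r, t₁, t₂, -, -, -, hx, -⟩ := id h
    obtain ⟨t, ht, -⟩ := hx.lt_place.exists_in
    exact htrans t (hN.branch_post_left ht (hN.branch_post_left ht h).symm)
  · exact htrans t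

theorem not_incompatible_self (hN : N.IsOccurrence) (x : P ⊕ T) :
    ¬ N.Incompatible x x := by
  rintro (h | h | h)
  · exact hN.not_clt_self x h
  · exact hN.not_clt_self x h
  · exact hN.not_branch_self x h

theorem pairwiseConcurrent_iff (hN : N.IsOccurrence) {C : Set P} :
    N.PairwiseConcurrent C ↔
      ∀ p ∈ C, ∀ q ∈ C, ¬ N.Incompatible (Sum.inl p) (Sum.inl q) := by
  constructor
  · intro h p hp q hq hi
    by_cases hpq : p = q
    · subst hpq
      exact hN.not_incompatible_self _ hi
    · exact hi.not_concurrent (h p hp q hq hpq)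
  · intro h p hp q hq hpq
    by_contra hc
    exact h p hp q hq (.of_not_concurrent (fun e => hpq (Sum.inl.inj e)) hc)

theorem isCut_iff (hN : N.IsOccurrence) {C : Set P} :
    N.IsCut C ↔ (∀ p ∈ C, ∀ q ∈ C, ¬ N.Incompatible (Sum.inl p) (Sum.inl q)) ∧
      ∀ x, (∀ c ∈ C, ¬ N.Incompatible (Sum.inl c) (Sum.inl x)) → x ∈ C := by
  unfold IsCut
  rw [hN.pairwiseConcurrent_iff]
  refine and_congr_right fun hC => ⟨fun h x hx => ?_, fun h D hD hCD => ?_⟩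
  · rw [← h (insert x C) ?_ (Set.subset_insert x C)]
    · exact Set.mem_insert x C
    · rw [hN.pairwiseConcurrent_iff]
      rintro p (rfl | hp) q (rfl | hq)
      · exact hN.not_incompatible_self _
      · exact fun hi => hx q hq hi.symm
      · exact hx p hp
      · exact hC p hp q hq
  · rw [hN.pairwiseConcurrent_iff] at hD
    exact (Set.Subset.antisymm hCD fun x hx => h x fun c hc => hD c (hCD hc) x hx).symm

theorem exists_init_le (hN : N.IsOccurrence) (x : P ⊕ T) :
    ∃ i ∈ N.init, N.CLe (Sum.inl i) x := by
  induction x using hN.wf.induction with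
  | _ x ih =>
    rcases x with p | t
    · by_cases hp : p ∈ N.init
      · exact ⟨p, hp, .refl⟩
      · rw [hN.mem_init] at hp
        push Not at hp
        obtain ⟨t, ht⟩ := hp
        obtain ⟨i, hi, hit⟩ := ih (Sum.inr t) ht
        exact ⟨i, hi, hit.tail ht⟩
    · obtain ⟨s, hs⟩ := Multiset.exists_mem_of_ne_zero (N.pre_ne t)
      obtain ⟨i, hi, his⟩ := ih (Sum.inl s) hs
      exact ⟨i, hi, his.tail hs⟩

theorem not_clt_init (hN : N.IsOccurrence) {x : P ⊕ T} {i : P} (hi : i ∈ N.init) :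
    ¬ N.CLt x (Sum.inl i) := by
  intro h
  obtain ⟨t, ht, -⟩ := h.exists_in
  exact (hN.mem_init i).1 hi t ht

theorem not_branch_init (hN : N.IsOccurrence) {y : P ⊕ T} {i : P} (hi : i ∈ N.init) :
    ¬ N.Branch (Sum.inl i) y := by
  rintro ⟨r, t₁, t₂, -, -, -, hx, -⟩
  exact hN.not_clt_init hi hx.lt_place

theorem isCut_init (hN : N.IsOccurrence) : N.IsCut {p | p ∈ N.init} := by
  rw [hN.isCut_iff]
  constructor
  · rintro p hp q hq (h | h | h)
    · exact hN.not_clt_init hq h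
    · exact hN.not_clt_init hp h
    · exact hN.not_branch_init hp h
  · intro x hx
    obtain ⟨i, hi, hix⟩ := hN.exists_init_le (Sum.inl x)
    rcases hix.eq_or_lt with h | h
    · cases h
      exact hi
    · exact (hx i hi (Or.inl h)).elim

/-- Firing a transition enabled in a pairwise compatible set preserves compatibility. -/
theorem compatible_fire (hN : N.IsOccurrence) {C : Set P} {t : T}
    (hC : ∀ p ∈ C, ∀ q ∈ C, ¬ N.Incompatible (Sum.inl p) (Sum.inl q))
    (ht : ∀ s ∈ N.pre t, s ∈ C) :
    ∀ p ∈ C \ {p | p ∈ N.pre t} ∪ {p | p ∈ N.post t},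
      ∀ q ∈ C \ {p | p ∈ N.pre t} ∪ {p | p ∈ N.post t},
        ¬ N.Incompatible (Sum.inl p) (Sum.inl q) := by
  have hmixed : ∀ p ∈ C \ {p | p ∈ N.pre t}, ∀ q ∈ N.post t,
      ¬ N.Incompatible (Sum.inl p) (Sum.inl q) := by
    rintro p ⟨hp, hpt⟩ q hq (h | h | h)
    · obtain h | h := (hN.le_of_lt_post hq h).eq_or_lt
      · cases h
      obtain ⟨s, hs, hps⟩ := h.exists_pre
      rcases hps.eq_or_lt with h | h
      · cases h
        exact hpt hs
      · exact hC p hp s (ht s hs) (Or.inl h)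
    · obtain ⟨s, hs⟩ := Multiset.exists_mem_of_ne_zero (N.pre_ne t)
      exact hC s (ht s hs) p hp
        (Or.inl (((clt_of_mem_pre hs).trans (clt_of_mem_post hq)).trans h))
    · obtain ⟨r, t₁, t₂, hne, h₁, h₂, hx, hy⟩ := hN.branch_post_left hq h.symm
      rcases hx.eq_or_lt with h | h
      · cases h
        exact hC r (ht r h₁) p hp (Or.inl ((clt_of_mem_pre h₂).trans_le hy))
      · obtain ⟨s, hs, hle⟩ := h.exists_pre
        exact hC s (ht s hs) p hp (Or.inr (Or.inr ⟨r, t₁, t₂, hne, h₁, h₂, hle, hy⟩))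
  have hpost : ∀ p ∈ N.post t, ∀ q ∈ N.post t, ¬ N.CLt (Sum.inl p) (Sum.inl q) :=
    fun p hp q hq h => hN.not_clt_self _
      ((clt_of_mem_post hp).trans_le (hN.le_of_lt_post hq h))
  rintro p (hp | hp) q (hq | hq)
  · exact hC p hp.1 q hq.1
  · exact hmixed p hp q hq
  · exact fun h => hmixed q hq p hp h.symm
  · rintro (h | h | h)
    · exact hpost p hp q hq h
    · exact hpost q hq p hp h
    · exact hN.not_branch_self _
        (hN.branch_post_left hq (hN.branch_post_left hp h).symm)

theorem isCut_fire (hN : N.IsOccurrence) {C : Set P} {t : T} (hC : N.IsCut C)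
    (ht : ∀ s ∈ N.pre t, s ∈ C) :
    N.IsCut (C \ {p | p ∈ N.pre t} ∪ {p | p ∈ N.post t}) := by
  rw [hN.isCut_iff] at hC ⊢
  obtain ⟨hC, hmax⟩ := hC
  refine ⟨hN.compatible_fire hC ht, fun x hx => ?_⟩
  obtain ⟨q, hq⟩ := Multiset.exists_mem_of_ne_zero (N.post_ne t)
  have hqx := hx q (Or.inr hq)
  have hpre : ∀ s ∈ N.pre t, N.CLt (Sum.inl s) (Sum.inl q) :=
    fun s hs => (clt_of_mem_pre hs).trans (clt_of_mem_post hq)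
  by_contra hxC'
  have hxC : x ∉ C := fun hxC => by
    by_cases hxt : x ∈ N.pre t
    · exact hqx (Or.inr (Or.inl (hpre x hxt)))
    · exact hxC' (Or.inl ⟨hxC, hxt⟩)
  refine hxC (hmax x fun m hm hi => ?_)
  by_cases hmt : m ∈ N.pre t
  · rcases hi with h | h | h
    · obtain ⟨u, hmu, hux⟩ := h.exists_out
      by_cases hut : u = t
      · subst hut
        obtain ⟨q', hq', hle⟩ := hux.lt_place.exists_post
        rcases hle.eq_or_lt with h' | h'
        · cases h'
          exact hxC' (Or.inr hq')
        · exact hx q' (Or.inr hq') (Or.inl h')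
      · exact hqx (Or.inr (Or.inr ⟨m, t, u, Ne.symm hut, hmt, hmu,
          (clt_of_mem_post hq).le, hux⟩))
    · exact hqx (Or.inr (Or.inl (h.trans (hpre m hmt))))
    · exact hqx (Or.inr (Or.inr (h.mono (hpre m hmt).le .refl)))
  · exact hx m (Or.inl ⟨hm, hmt⟩) hi

theorem finite_setOf_cle (hN : N.IsOccurrence) (y : P ⊕ T) :
    {x | N.CLe x y}.Finite := by
  induction y using hN.wf.induction with
  | _ y ih =>
    have hpred : {z | N.Flow z y}.Finite := by
      rcases y with p | t
      · refine Set.Subsingleton.finite ?_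
        rintro (q | t) ht (q' | t') ht'
        · exact ht.elim
        · exact ht.elim
        · exact ht'.elim
        · exact congrArg Sum.inr (hN.unique_pre p t t' ht ht')
      · classical
        refine ((N.pre t).toFinset.finite_toSet.image Sum.inl).subset ?_
        rintro (q | u) h
        · exact ⟨q, Multiset.mem_toFinset.2 h, rfl⟩
        · exact h.elim
    refine ((Set.finite_singleton y).union (hpred.biUnion ih)).subset ?_
    intro x hx
    rcases hx.cases_tail with h | ⟨z, hxz, hzy⟩
    · exact Or.inl h.symm
    · exact Or.inr (Set.mem_biUnion hzy hxz)

theorem post_le_of_le (hN : N.IsOccurrence) {C : Set P} (hC : N.IsCut C) {c : P} (hc : c ∈ C)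
    {t : T} (ht : N.CLe (Sum.inr t) (Sum.inl c)) {q : P} (hq : q ∈ N.post t) :
    ∃ c ∈ C, N.CLe (Sum.inl q) (Sum.inl c) := by
  rw [hN.isCut_iff] at hC
  by_contra! hno
  refine hno q (hC.2 q ?_) .refl
  rintro c' hc' (h | h | h)
  · exact hC.1 c' hc' c hc (Or.inl ((hN.le_of_lt_post hq h).trans_lt ht.lt_place))
  · exact hno c' hc' h.le
  · exact hC.1 c hc c' hc' (Or.inr (Or.inr
      ((hN.branch_post_left hq h.symm).mono ht .refl)))

/-- A cut `M` lying below a cut `C` enables every minimal transition among those below `C`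
that are not below `M`. -/
theorem pre_subset_of_minimal (hN : N.IsOccurrence) {C M : Set P} (hC : N.IsCut C)
    (hM : N.IsCut M) (hMC : ∀ m ∈ M, ∃ c ∈ C, N.CLe (Sum.inl m) (Sum.inl c))
    {c : P} (hc : c ∈ C) {t : T} (htc : N.CLe (Sum.inr t) (Sum.inl c))
    (htM : ∀ m ∈ M, ¬ N.CLe (Sum.inr t) (Sum.inl m))
    (hmin : ∀ u, N.CLt (Sum.inr u) (Sum.inr t) → ∃ m ∈ M, N.CLe (Sum.inr u) (Sum.inl m)) :
    ∀ s ∈ N.pre t, s ∈ M := by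
  rw [hN.isCut_iff] at hC hM
  intro s hs
  refine hM.2 s ?_
  have hst := clt_of_mem_pre hs
  have hbranch : ∀ m ∈ M, ¬ N.Branch (Sum.inl m) (Sum.inl c) := by
    intro m hm h
    obtain ⟨c', hc', hmc'⟩ := hMC m hm
    exact hC.1 c' hc' c hc (Or.inr (Or.inr (h.mono hmc' .refl)))
  rintro m hm (h | h | h)
  · obtain ⟨u, hu, hmu⟩ := h.exists_in
    obtain ⟨m', hm', hum'⟩ := hmin u ((clt_of_mem_post hu).trans hst)
    exact hM.1 m hm m' hm' (Or.inl (hmu.trans_lt hum'.lt_place))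
  · obtain ⟨u, hu, hum⟩ := h.exists_out
    by_cases hut : u = t
    · subst hut
      exact htM m hm hum
    · exact hbranch m hm ⟨s, u, t, hut, hu, hs, hum, htc⟩
  · exact hbranch m hm (h.mono .refl (hst.trans_le htc).le)

theorem init_le_of_isCut (hN : N.IsOccurrence) {C : Set P} (hC : N.IsCut C) :
    ∀ i ∈ N.init, ∃ c ∈ C, N.CLe (Sum.inl i) (Sum.inl c) := by
  rw [hN.isCut_iff] at hC
  intro i hi
  by_contra! hno
  refine hno i (hC.2 i ?_) .refl
  rintro c hc (h | h | h)
  · exact hN.not_clt_init hi h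
  · exact hno c hc h.le
  · exact hN.not_branch_init hi h.symm

variable [DecidableEq P]

theorem fire_nodup (hN : N.IsOccurrence) {M : Multiset P} {t : T} (hM : M.Nodup)
    (hcut : N.IsCut {p | p ∈ M}) (ht : N.pre t ≤ M) :
    (M - N.pre t + N.post t).Nodup := by
  rw [hN.isCut_iff] at hcut
  refine Multiset.nodup_add.2 ⟨Multiset.nodup_of_le (Multiset.sub_le_self _ _) hM,
    hN.post_nodup t, Multiset.disjoint_left.2 fun {p} hp hq => ?_⟩
  obtain ⟨s, hs⟩ := Multiset.exists_mem_of_ne_zero (N.pre_ne t)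
  exact hcut.1 s (Multiset.mem_of_le ht hs) p (Multiset.mem_of_le (Multiset.sub_le_self _ _) hp)
    (Or.inl ((clt_of_mem_pre hs).trans (clt_of_mem_post hq)))

theorem setOf_mem_fire {M : Multiset P} (t : T) (hM : M.Nodup) :
    {p | p ∈ M - N.pre t + N.post t} =
      {p | p ∈ M} \ {p | p ∈ N.pre t} ∪ {p | p ∈ N.post t} := by
  ext p
  simp [Multiset.mem_sub_of_nodup hM]

theorem nodup_and_isCut_of_reachable (hN : N.IsOccurrence) {M : Multiset P}
    (h : N.Reachable M) : M.Nodup ∧ N.IsCut {p | p ∈ M} := by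
  induction h with
  | refl => exact ⟨hN.init_nodup, hN.isCut_init⟩
  | tail _ hstep ih =>
    obtain ⟨t, hen, rfl⟩ := hstep
    refine ⟨hN.fire_nodup ih.1 ih.2 hen, ?_⟩
    rw [setOf_mem_fire t ih.1]
    exact hN.isCut_fire ih.2 fun s hs => Multiset.mem_of_le hen hs

theorem exists_reachable_of_below (hN : N.IsOccurrence) {C : Set P} (hC : N.IsCut C)
    (hfin : C.Finite) (M : Multiset P) (hM : N.Reachable M)
    (hMC : ∀ m ∈ M, ∃ c ∈ C, N.CLe (Sum.inl m) (Sum.inl c)) :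
    ∃ M' : Multiset P, N.Reachable M' ∧ {p | p ∈ M'} = C := by
  obtain ⟨hnodup, hcut⟩ := hN.nodup_and_isCut_of_reachable hM
  let S : Multiset P → Set (P ⊕ T) := fun M =>
    {x | ∃ t, x = Sum.inr t ∧ (∃ c ∈ C, N.CLe x (Sum.inl c)) ∧ ∀ m ∈ M, ¬ N.CLe x (Sum.inl m)}
  have hSfin : (S M).Finite := by
    refine (hfin.biUnion fun c _ => hN.finite_setOf_cle (Sum.inl c)).subset ?_
    rintro x ⟨-, -, ⟨c, hc, hxc⟩, -⟩
    exact Set.mem_biUnion hc hxc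
  induction hn : (S M).ncard using Nat.strong_induction_on generalizing M with
  | _ n ih =>
    rcases (S M).eq_empty_or_nonempty with hS | hS
    · refine ⟨M, hM, (hcut.2 C hC.1 fun m hm => ?_).symm⟩
      obtain ⟨c, hc, hmc⟩ := hMC m hm
      rcases hmc.eq_or_lt with h | h
      · cases h
        exact hc
      · obtain ⟨t, hmt, htc⟩ := h.exists_out
        have ht : Sum.inr t ∉ S M := by simp [hS]
        obtain ⟨m', hm', htm'⟩ : ∃ m' ∈ M, N.CLe (Sum.inr t) (Sum.inl m') := by
          by_contra! hno
          exact ht ⟨t, rfl, ⟨c, hc, htc⟩, hno⟩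
        exact ((hN.isCut_iff.1 hcut).1 m hm m' hm'
          (Or.inl ((clt_of_mem_pre hmt).trans_le htm'))).elim
    · obtain ⟨-, ⟨t, rfl, ⟨c, hc, htc⟩, htM⟩, hmin⟩ := hN.wf.transGen.has_min (S M) hS
      have hpre : ∀ s ∈ N.pre t, s ∈ M :=
        hN.pre_subset_of_minimal hC hcut hMC hc htc htM fun u hu => by
          by_contra! hno
          exact hmin (Sum.inr u) ⟨u, rfl, ⟨c, hc, hu.le.trans htc⟩, hno⟩ hu
      have hen : N.pre t ≤ M := (Multiset.le_iff_subset (hN.pre_nodup t)).2 hpre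
      have hM' : N.Reachable (M - N.pre t + N.post t) := hM.tail ⟨t, hen, rfl⟩
      obtain ⟨hnodup', hcut'⟩ := hN.nodup_and_isCut_of_reachable hM'
      obtain ⟨q, hq⟩ := Multiset.exists_mem_of_ne_zero (N.post_ne t)
      have hqM' : q ∈ M - N.pre t + N.post t := Multiset.mem_add.2 (Or.inr hq)
      have hssub : S (M - N.pre t + N.post t) ⊂ S M := by
        refine (Set.ssubset_iff_of_subset ?_).2 ⟨Sum.inr t, ⟨t, rfl, ⟨c, hc, htc⟩, htM⟩, ?_⟩
        · rintro x ⟨u, hxu, hxC, hxM'⟩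
          refine ⟨u, hxu, hxC, fun m hm hxm => ?_⟩
          by_cases hmt : m ∈ N.pre t
          · exact hxM' q hqM'
              (hxm.trans ((clt_of_mem_pre hmt).trans (clt_of_mem_post hq)).le)
          · exact hxM' m (Multiset.mem_add.2
              (Or.inl ((Multiset.mem_sub_of_nodup hnodup).2 ⟨hm, hmt⟩))) hxm
        · rintro ⟨-, -, -, h⟩
          exact h q hqM' (clt_of_mem_post hq).le
      refine ih _ (hn ▸ Set.ncard_lt_ncard hssub hSfin) _ hM' (fun m hm => ?_) hnodup' hcut'
        (hSfin.subset hssub.subset) rfl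
      rcases Multiset.mem_add.1 hm with hm | hm
      · exact hMC m (Multiset.mem_of_le (Multiset.sub_le_self _ _) hm)
      · exact hN.post_le_of_le hC hc htc hm

end IsOccurrence

end PetriNet


/-- In any occurrence net, the finite cuts are exactly the reachable markings:
every reachable marking is a finite cut, and every finite cut is reachable from
the initial marking by firing a finite sequence of transitions. -/
theorem finite_cuts_eq_reachable {P T : Type} [DecidableEq P] (N : PetriNet P T)
    (hN : N.IsOccurrence) :
    (∀ M : Multiset P, N.Reachable M →
      M.Nodup ∧ {p : P | p ∈ M}.Finite ∧ N.IsCut {p : P | p ∈ M}) ∧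
    (∀ C : Set P, N.IsCut C → C.Finite →
      ∃ M : Multiset P, N.Reachable M ∧ M.Nodup ∧ {p : P | p ∈ M} = C) := by
  refine ⟨fun M hM => ?_, fun C hC hfin => ?_⟩
  · obtain ⟨hnodup, hcut⟩ := hN.nodup_and_isCut_of_reachable hM
    exact ⟨hnodup, Multiset.finite_toSet M, hcut⟩
  · obtain ⟨M, hM, hMC⟩ := hN.exists_reachable_of_below hC hfin N.init .refl
      (hN.init_le_of_isCut hC)
    exact ⟨M, hM, (hN.nodup_and_isCut_of_reachable hM).1, hMC⟩
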